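/- arXiv:2601.16243 — 3 statements merged into one kernel-verified Lean document; each statement's English description precedes it below -/
import Mathlib

section
/- Let G be a nontrivial finite group such that for every group word w the verbal subgroup w(G) equals either the trivial subgroup or G itself. Then there exist a finite simple group S and an integer n ≥ 1 such that G is isomorphic to the direct product of n copies of S. -/
/-- The verbal subgroup of `G` associated with a group word `w` (an element of the free
group on countably many generators): the subgroup generated by all values of `w`, i.e. by
the image of `w` under all homomorphisms from the free group to `G`. -/
def verbalSubgroup (G : Type*) [Group G] (w : FreeGroup ℕ) : Subgroup G :=
  Subgroup.closure (Set.range fun φ : FreeGroup ℕ →* G => φ w)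

/-- A nontrivial finite group has a simple quotient. -/
lemma exists_isSimpleGroup_quotient (G : Type*) [Group G] [Finite G] [Nontrivial G] :
    ∃ (N : Subgroup G) (_ : N.Normal), IsSimpleGroup (G ⧸ N) := by
  have hfin : {N : Subgroup G | N.Normal ∧ N ≠ ⊤}.Finite := Set.toFinite _
  obtain ⟨N, ⟨hN, hN'⟩, hmax⟩ :=
    hfin.exists_maximal ⟨⊥, (inferInstance : (⊥ : Subgroup G).Normal), bot_ne_top⟩
  refine ⟨N, hN, ?_⟩
  have : Nontrivial (G ⧸ N) := QuotientGroup.nontrivial_iff.mpr hN'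
  refine ⟨fun H hH => ?_⟩
  have hsurj := QuotientGroup.mk'_surjective N
  have hle : N ≤ H.comap (QuotientGroup.mk' N) := by
    simpa using (QuotientGroup.mk' N).ker_le_comap H
  by_cases htop : H.comap (QuotientGroup.mk' N) = ⊤
  · right
    rw [← Subgroup.map_comap_eq_self_of_surjective hsurj H, htop,
      Subgroup.map_top_of_surjective _ hsurj]
  · left
    have := le_antisymm (hmax ⟨hH.comap _, htop⟩ hle) hle
    rw [← Subgroup.map_comap_eq_self_of_surjective hsurj H, this, QuotientGroup.map_mk'_self]

section NonabelianSimple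

open scoped commutatorElement

variable {F S : Type*} [Group F] [Group S] [IsSimpleGroup S]

lemma map_eq_top_of_not_le_ker {φ : F →* S} (hφ : Function.Surjective φ)
    {A : Subgroup F} (hA : A.Normal) (h : ¬ A ≤ φ.ker) : A.map φ = ⊤ :=
  ((hA.map φ hφ).eq_bot_or_eq_top).resolve_left fun h' => h ((A.map_eq_bot_iff).mp h')

/-- The kernel of a surjection onto a nonabelian simple group is a prime normal subgroup. -/
lemma le_ker_or_le_ker_of_inf_le_ker (hS : commutator S = ⊤) {ψ : F →* S}
    (hψ : Function.Surjective ψ) {A B : Subgroup F} (hA : A.Normal) (hB : B.Normal)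
    (h : A ⊓ B ≤ ψ.ker) : A ≤ ψ.ker ∨ B ≤ ψ.ker := by
  by_contra! hcon
  have h1 : ⁅A, B⁆ ≤ ψ.ker := (Subgroup.commutator_le_inf A B).trans h
  rw [← Subgroup.map_eq_bot_iff, Subgroup.map_commutator,
    map_eq_top_of_not_le_ker hψ hA hcon.1, map_eq_top_of_not_le_ker hψ hB hcon.2,
    ← commutator_def, hS] at h1
  exact top_ne_bot h1

lemma exists_le_ker_of_iInf_le_ker (hS : commutator S = ⊤) {ψ : F →* S}
    (hψ : Function.Surjective ψ) {ι : Type*} (A : ι → Subgroup F) (hA : ∀ i, (A i).Normal)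
    (s : Finset ι) (h : ⨅ i ∈ s, A i ≤ ψ.ker) : ∃ i ∈ s, A i ≤ ψ.ker := by
  classical
  induction s using Finset.induction_on with
  | empty =>
    have : ψ.range = ⊥ := by
      rw [MonoidHom.range_eq_map, Subgroup.map_eq_bot_iff]
      simpa using h
    rw [MonoidHom.range_eq_top.mpr hψ] at this
    exact absurd this top_ne_bot
  | insert a s ha ih =>
    rw [Finset.iInf_insert] at h
    rcases le_ker_or_le_ker_of_inf_le_ker hS hψ (hA a)
      (Subgroup.normal_iInf_normal fun i => Subgroup.normal_iInf_normal fun _ => hA i) h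
      with h | h
    · exact ⟨a, Finset.mem_insert_self a s, h⟩
    · obtain ⟨i, hi, h⟩ := ih h
      exact ⟨i, Finset.mem_insert_of_mem hi, h⟩

/-- If a normal subgroup `K` contains the intersection of finitely many kernels of surjections
onto a nonabelian simple group `S`, then the quotient by `K` is a power of `S`. -/
lemma exists_surjective_pi_ker_eq (hS : commutator S = ⊤) {ι : Type*} (φ : ι → F →* S)
    (hφ : ∀ i, Function.Surjective (φ i)) (s : Finset ι) (K : Subgroup F) (hK : K.Normal)
    (h : ⨅ i ∈ s, (φ i).ker ≤ K) :
    ∃ (n : ℕ) (ψ : F →* (Fin n → S)), Function.Surjective ψ ∧ ψ.ker = K := by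
  classical
  induction s using Finset.induction_on generalizing K with
  | empty =>
    refine ⟨0, 1, fun x => ⟨1, Subsingleton.elim _ _⟩, ?_⟩
    simp only [Finset.notMem_empty, iInf_false, iInf_top, top_le_iff] at h
    rw [h, MonoidHom.ker_one]
  | insert a s ha ih =>
    rw [Finset.iInf_insert] at h
    have hL : (⨅ i ∈ s, (φ i).ker).Normal :=
      Subgroup.normal_iInf_normal fun i => Subgroup.normal_iInf_normal fun _ => inferInstance
    set L := ⨅ i ∈ s, (φ i).ker
    by_cases hLM : L ≤ (φ a).ker
    · exact ih K hK ((le_inf hLM le_rfl).trans h)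
    have hLtop := map_eq_top_of_not_le_ker (hφ a) hL hLM
    by_cases hKM : K ≤ (φ a).ker
    · obtain ⟨n, ψ, hψ, hker⟩ := ih (K ⊔ L) inferInstance le_sup_right
      let θ : F →* (Fin (n + 1) → S) :=
        MonoidHom.pi (Fin.cons (φ a) fun i => (Pi.evalMonoidHom _ i).comp ψ)
      have hθ0 : ∀ x, θ x 0 = φ a x := fun _ => rfl
      have hθsucc : ∀ x (i : Fin n), θ x i.succ = ψ x i := fun _ _ => rfl
      refine ⟨n + 1, θ, fun x => ?_, ?_⟩
      · obtain ⟨f, hf⟩ := hψ (Fin.tail x)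
        have hx : x 0 * (φ a f)⁻¹ ∈ L.map (φ a) := hLtop ▸ Subgroup.mem_top _
        obtain ⟨l, hl, hlx⟩ := hx
        have hl' : ψ l = 1 := by
          rw [← MonoidHom.mem_ker, hker]
          exact Subgroup.mem_sup_right hl
        refine ⟨l * f, funext fun i => ?_⟩
        refine Fin.cases ?_ (fun j => ?_) i
        · simp [hθ0, hlx]
        · have := congrFun hf j
          simpa [hθsucc, hl', Fin.tail] using this
      · have hmod : (φ a).ker ⊓ (K ⊔ L) = K := by
          refine le_antisymm ?_ (le_inf hKM le_sup_left)
          rintro x ⟨hxM, hxKL⟩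
          obtain ⟨k, hk, l, hl, rfl⟩ := Subgroup.mem_sup_of_normal_left.mp hxKL
          refine K.mul_mem hk (h ⟨?_, hl⟩)
          exact ((φ a).ker.mul_mem_cancel_left (hKM hk)).mp hxM
        rw [← hmod, ← hker]
        ext x
        simp [MonoidHom.mem_ker, funext_iff, Fin.forall_fin_succ, hθ0, hθsucc]
    · have hKtop := map_eq_top_of_not_le_ker (hφ a) hK hKM
      refine ih K hK fun l hl => ?_
      have hLF : ∀ x ∈ L, ∀ y : F, ⁅x, y⁆ ∈ K := by
        intro x hx y
        have hy : φ a y ∈ K.map (φ a) := hKtop ▸ Subgroup.mem_top _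
        obtain ⟨k, hk, hky⟩ := hy
        have hm : y * k⁻¹ ∈ (φ a).ker := by simp [MonoidHom.mem_ker, hky]
        have h1 : ⁅x, y * k⁻¹⁆ ∈ K := h (by
          have := Subgroup.commutator_le_inf L (φ a).ker (Subgroup.commutator_mem_commutator hx hm)
          exact ⟨this.2, this.1⟩)
        have h2 : ⁅x, k⁆ ∈ K := Subgroup.commutator_le_right ⊤ K
          (Subgroup.commutator_mem_commutator (Subgroup.mem_top x) hk)
        have h3 : ⁅x, y⁆ = ⁅x, y * k⁻¹⁆ * ((y * k⁻¹) * ⁅x, k⁆ * (y * k⁻¹)⁻¹) := by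
          simp only [commutatorElement_def]; group
        rw [h3]
        exact K.mul_mem h1 (hK.conj_mem _ h2 _)
      have hLL : ⁅L, L⁆ ≤ K := Subgroup.commutator_le.mpr fun x hx y _ => hLF x hx y
      have hl' : φ a l ∈ (⁅L, L⁆).map (φ a) := by
        rw [Subgroup.map_commutator, hLtop, ← commutator_def, hS]
        exact Subgroup.mem_top _
      obtain ⟨c, hc, hcl⟩ := hl'
      have hcL : c ∈ L := Subgroup.commutator_le_left L L hc
      have : c⁻¹ * l ∈ K := h ⟨by simp [hcl], L.mul_mem (L.inv_mem hcL) hl⟩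
      exact (K.mul_mem_cancel_left (K.inv_mem (hLL hc))).mp this

end NonabelianSimple

section Verbal

open scoped commutatorElement

variable {G : Type*} [Group G]

lemma mul_comm_of_commutator_eq_bot (h : commutator G = ⊥) (a b : G) : a * b = b * a := by
  have hab : ⁅a, b⁆ ∈ commutator G :=
    Subgroup.commutator_mem_commutator (Subgroup.mem_top a) (Subgroup.mem_top b)
  rwa [h, Subgroup.mem_bot, commutatorElement_eq_one_iff_mul_comm] at hab

lemma closure_range_eq_bot_or_eq_top {α : Type*} [Countable α] [Nonempty α]
    (hw : ∀ w : FreeGroup ℕ, verbalSubgroup G w = ⊥ ∨ verbalSubgroup G w = ⊤)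
    (w : FreeGroup α) :
    Subgroup.closure (Set.range fun φ : FreeGroup α →* G => φ w) = ⊥ ∨
      Subgroup.closure (Set.range fun φ : FreeGroup α →* G => φ w) = ⊤ := by
  obtain ⟨e, he⟩ := exists_injective_nat α
  convert hw (FreeGroup.map e w) using 2 <;>
  · unfold verbalSubgroup
    congr 1
    ext g
    constructor
    · rintro ⟨φ, rfl⟩
      refine ⟨φ.comp (FreeGroup.map (Function.invFun e)), ?_⟩
      simp [FreeGroup.map.comp, Function.invFun_comp he]
    · rintro ⟨φ, rfl⟩
      exact ⟨φ.comp (FreeGroup.map e), rfl⟩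

lemma apply_eq_one_of_law {α S : Type*} [Countable α] [Nonempty α] [Group S] [Nontrivial S]
    (hw : ∀ w : FreeGroup ℕ, verbalSubgroup G w = ⊥ ∨ verbalSubgroup G w = ⊤)
    {ρ : G →* S} (hρ : Function.Surjective ρ) (w : FreeGroup α)
    (h : ∀ φ : FreeGroup α →* S, φ w = 1) (φ : FreeGroup α →* G) : φ w = 1 := by
  have hmem := Subgroup.subset_closure (Set.mem_range_self (f := fun φ : FreeGroup α →* G => φ w) φ)
  rcases closure_range_eq_bot_or_eq_top hw w with h' | h'
  · rwa [h'] at hmem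
  · have hle : Subgroup.closure (Set.range fun φ : FreeGroup α →* G => φ w) ≤ ρ.ker := by
      rw [Subgroup.closure_le]
      rintro _ ⟨φ, rfl⟩
      exact h (ρ.comp φ)
    obtain ⟨x, hx⟩ := exists_ne (1 : S)
    obtain ⟨g, rfl⟩ := hρ x
    exact absurd (hle (h' ▸ Subgroup.mem_top g)) hx

/-- The nonabelian case: if a simple quotient is perfect, the group is a power of it. -/
lemma exists_mulEquiv_pi_of_commutator_eq_top [Finite G] {S : Type*} [Group S] [IsSimpleGroup S]
    (hw : ∀ w : FreeGroup ℕ, verbalSubgroup G w = ⊥ ∨ verbalSubgroup G w = ⊤)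
    {ρ : G →* S} (hρ : Function.Surjective ρ) (hS : commutator S = ⊤) :
    ∃ n : ℕ, Nonempty (G ≃* (Fin n → S)) := by
  classical
  have : Finite S := Finite.of_surjective ρ hρ
  have : Finite (FreeGroup G →* S) := Finite.of_equiv _ (FreeGroup.lift (α := G) (β := S))
  let π : FreeGroup G →* G := FreeGroup.lift id
  have hπ : Function.Surjective π := fun g => ⟨FreeGroup.of g, by simp [π]⟩
  let T := {φ : FreeGroup G →* S // ¬ Function.Surjective φ}
  let B : Subgroup (FreeGroup G) := ⨅ φ : T, φ.1.ker
  have hBn : B.Normal := Subgroup.normal_iInf_normal fun _ => inferInstance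
  have hB : ∀ e : FreeGroup G →* FreeGroup G, ∀ b ∈ B, e b ∈ B := by
    intro e b hb
    rw [Subgroup.mem_iInf] at hb ⊢
    intro φ
    exact hb ⟨φ.1.comp e, fun h => φ.2 (Function.Surjective.of_comp h)⟩
  have hBπ : ¬ B ≤ π.ker := by
    intro hle
    have := Fintype.ofFinite T
    have hρπ : Function.Surjective (ρ.comp π) := hρ.comp hπ
    obtain ⟨φ, -, hφ⟩ := exists_le_ker_of_iInf_le_ker hS (ψ := ρ.comp π) hρπ
      (fun φ : T => φ.1.ker) (fun _ => inferInstance) Finset.univ (by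
        have : (⨅ φ ∈ (Finset.univ : Finset T), φ.1.ker) = B := by simp [B]
        rw [this]
        intro x hx
        have hx' : π x = 1 := hle hx
        simp [MonoidHom.mem_ker, hx'])
    refine φ.2 (MonoidHom.range_eq_top.mp (Subgroup.eq_top_of_le_card _ ?_))
    have hdvd := Subgroup.index_dvd_of_le hφ
    rw [Subgroup.index_ker, Subgroup.index_ker, MonoidHom.range_eq_top.mpr hρπ,
      Subgroup.card_top] at hdvd
    exact Nat.le_of_dvd Nat.card_pos hdvd
  have hBtop : B.map π = ⊤ := by
    obtain ⟨w, hwB, hwπ⟩ := SetLike.not_le_iff_exists.mp hBπ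
    have hmem := Subgroup.subset_closure
      (Set.mem_range_self (f := fun φ : FreeGroup G →* G => φ w) π)
    rcases closure_range_eq_bot_or_eq_top hw w with h | h
    · rw [h] at hmem
      exact absurd hmem hwπ
    · rw [eq_top_iff, ← h, Subgroup.closure_le]
      rintro _ ⟨φ, rfl⟩
      let e : FreeGroup G →* FreeGroup G := FreeGroup.lift fun g => FreeGroup.of (φ (FreeGroup.of g))
      have he : π.comp e = φ := by
        ext g
        simp [π, e]
      exact ⟨e w, hB e w hwB, DFunLike.congr_fun he w⟩
  have hπB : Function.Surjective (π.comp B.subtype) := by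
    intro g
    have hg : g ∈ B.map π := hBtop ▸ Subgroup.mem_top g
    obtain ⟨b, hb, rfl⟩ := hg
    exact ⟨⟨b, hb⟩, rfl⟩
  let ι := {φ : FreeGroup G →* S // Function.Surjective (φ.comp B.subtype)}
  have := Fintype.ofFinite ι
  obtain ⟨n, ψ, hψ, hker⟩ := exists_surjective_pi_ker_eq hS
    (fun φ : ι => φ.1.comp B.subtype) (fun φ => φ.2) Finset.univ (π.comp B.subtype).ker
    inferInstance (by
      intro b hb
      simp only [Finset.mem_univ, iInf_pos, Subgroup.mem_iInf] at hb
      refine apply_eq_one_of_law hw hρ (b : FreeGroup G) (fun φ => ?_) π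
      by_cases hφB : Function.Surjective (φ.comp B.subtype)
      · exact hb ⟨φ, hφB⟩
      by_cases hφ : Function.Surjective φ
      · by_contra hne
        have htop := map_eq_top_of_not_le_ker hφ hBn fun hle => hne (hle b.2)
        refine hφB fun s => ?_
        have hs : s ∈ B.map φ := htop ▸ Subgroup.mem_top s
        obtain ⟨c, hc, rfl⟩ := hs
        exact ⟨⟨c, hc⟩, rfl⟩
      · exact Subgroup.mem_iInf.mp b.2 ⟨φ, hφ⟩)
  exact ⟨n, ⟨(QuotientGroup.quotientKerEquivOfSurjective _ hπB).symm.trans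
    ((QuotientGroup.quotientMulEquivOfEq hker.symm).trans
      (QuotientGroup.quotientKerEquivOfSurjective ψ hψ))⟩⟩

/-- The abelian case: if a simple quotient is commutative, the group is elementary abelian. -/
lemma exists_mulEquiv_pi_of_mul_comm [Finite G] {S : Type*} [Group S] [IsSimpleGroup S]
    (hw : ∀ w : FreeGroup ℕ, verbalSubgroup G w = ⊥ ∨ verbalSubgroup G w = ⊤)
    {ρ : G →* S} (hρ : Function.Surjective ρ) (hS : ∀ a b : S, a * b = b * a) :
    ∃ n : ℕ, Nonempty (G ≃* (Fin n → S)) := by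
  let _ : CommGroup S := { ‹Group S› with mul_comm := hS }
  have : Finite S := Finite.of_surjective ρ hρ
  have hp : (Nat.card S).Prime := IsSimpleGroup.prime_card
  set p := Nat.card S with hpdef
  have : Fact p.Prime := ⟨hp⟩
  have hcomm : ∀ a b : G, a * b = b * a := by
    intro a b
    have h := apply_eq_one_of_law hw hρ
      ⁅FreeGroup.of (0 : ℕ), FreeGroup.of (1 : ℕ)⁆ (fun φ => by
        rw [map_commutatorElement, commutatorElement_eq_one_iff_mul_comm]
        exact hS _ _) (FreeGroup.lift fun i => if i = 0 then a else b)
    rw [map_commutatorElement, commutatorElement_eq_one_iff_mul_comm] at h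
    simpa using h
  let _ : CommGroup G := { ‹Group G› with mul_comm := hcomm }
  have hpow : ∀ a : G, a ^ p = 1 := by
    intro a
    have h := apply_eq_one_of_law hw hρ (FreeGroup.of (0 : ℕ) ^ p) (fun φ => by
        rw [map_pow, hpdef, pow_card_eq_one']) (FreeGroup.lift fun _ => a)
    simpa using h
  let instM : Module (ZMod p) (Additive G) := AddCommGroup.zmodModule (n := p) fun a => hpow a.toMul
  have : Module.Finite (ZMod p) (Additive G) := Module.Finite.of_finite (R := ZMod p)
  let b := Module.finBasis (ZMod p) (Additive G)
  have : IsCyclic S := isCyclic_of_prime_card (p := p) rfl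
  let f : Multiplicative (ZMod p) ≃* S := zmodCyclicMulEquiv this
  let g : Additive G ≃+ (Fin (Module.finrank (ZMod p) (Additive G)) → Additive S) :=
    b.equivFun.toAddEquiv.trans
      (AddEquiv.piCongrRight fun _ => MulEquiv.toAdditiveRight f)
  exact ⟨_, ⟨{ toFun := fun x i => (g (Additive.ofMul x) i).toMul
               invFun := fun y => (g.symm fun i => Additive.ofMul (y i)).toMul
               left_inv := fun x => by simp
               right_inv := fun y => by simp
               map_mul' := fun x y => by ext i; simp }⟩⟩

end Verbal

theorem stmt5 (G : Type*) [Group G] [Finite G] [Nontrivial G]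
    (hw : ∀ w : FreeGroup ℕ, verbalSubgroup G w = ⊥ ∨ verbalSubgroup G w = ⊤) :
    ∃ (S : Type) (instS : Group S), letI := instS;
      Finite S ∧ IsSimpleGroup S ∧
        ∃ n : ℕ, 1 ≤ n ∧ Nonempty (G ≃* (Fin n → S)) := by
  obtain ⟨N, hN, hsimple⟩ := exists_isSimpleGroup_quotient G
  have hρ := QuotientGroup.mk'_surjective N
  have hpow : ∃ n : ℕ, Nonempty (G ≃* (Fin n → G ⧸ N)) := by
    rcases (inferInstance : (commutator (G ⧸ N)).Normal).eq_bot_or_eq_top with h | h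
    · refine exists_mulEquiv_pi_of_mul_comm hw hρ fun a b => ?_
      exact mul_comm_of_commutator_eq_bot h a b
    · exact exists_mulEquiv_pi_of_commutator_eq_top hw hρ h
  obtain ⟨n, ⟨e⟩⟩ := hpow
  let σ : Shrink.{0} (G ⧸ N) ≃* G ⧸ N := Shrink.mulEquiv
  refine ⟨Shrink.{0} (G ⧸ N), inferInstance, Finite.of_equiv _ σ.symm.toEquiv,
    σ.isSimpleGroup, n, ?_, ⟨e.trans (MulEquiv.piCongrRight fun _ => σ.symm)⟩⟩
  rw [Nat.one_le_iff_ne_zero]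
  rintro rfl
  exact not_subsingleton G e.toEquiv.subsingleton
end

section
/- Fix a prime p and an integer n ≥ 1. Let s ⊆ Z be a finite set and let A_u ∈ M_n(Z/pZ) for u ∈ s be matrices defining the one-dimensional linear cellular automaton F on ((Z/pZ)^n)^Z by F(c)_z = Σ_{u∈s} A_u · c_{z+u}. Let R = (Z/pZ)[x, x^{-1}] be the Laurent polynomial ring over Z/pZ, let M = Σ_{u∈s} x^u A_u ∈ M_n(R), and let χ(t) ∈ R[t] be the characteristic polynomial of M. Then F is topologically transitive if and only if F is surjective and, for every i ∈ {1, …, n}, χ(t) and t^{p^i − 1} − 1 are relatively prime in R[t] (every common divisor is a unit). -/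
open Polynomial

/-- A self-map `T` of a topological space `X` is topologically transitive if for all
nonempty open sets `U, V ⊆ X` there exists `m ≥ 0` with `T^m(U) ∩ V ≠ ∅`. -/
def TopologicallyTransitive {X : Type*} [TopologicalSpace X] (T : X → X) : Prop :=
  ∀ U V : Set X, IsOpen U → IsOpen V → U.Nonempty → V.Nonempty →
    ∃ n : ℕ, (T^[n] '' U ∩ V).Nonempty

theorem Matrix.det_pow_sub_one_eq_zero_of_dvd_charpoly {R ι : Type*} [CommRing R] [IsDomain R]
    [Fintype ι] [DecidableEq ι] (N : Matrix ι ι R) (q : ℕ) {f : R[X]} (hf : ¬ IsUnit f)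
    (hchar : f ∣ N.charpoly) (hq : f ∣ X ^ q - 1) : (N ^ q - 1).det = 0 := by
  let L := AlgebraicClosure (FractionRing R)
  let φ : R →+* L := (algebraMap (FractionRing R) L).comp (algebraMap R (FractionRing R))
  have hφ : Function.Injective φ :=
    (algebraMap (FractionRing R) L).injective.comp (IsFractionRing.injective R (FractionRing R))
  have hdeg : f.degree ≠ 0 := by
    intro h
    rw [eq_C_of_degree_eq_zero h] at hf hchar
    exact hf ((N.charpoly_monic.C_dvd_iff_isUnit.mp hchar).map C)
  obtain ⟨ζ, hζ⟩ := IsAlgClosed.exists_root (f.map φ) (by rwa [degree_map_eq_of_injective hφ])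
  have hroot : (N.map φ).charpoly.IsRoot ζ := by
    rw [Matrix.charpoly_map]
    exact hζ.dvd (Polynomial.map_dvd φ hchar)
  have hdvd : X - C ζ ∣ (X ^ q - 1 : L[X]) := by
    have := Polynomial.map_dvd φ hq
    simp only [Polynomial.map_sub, Polynomial.map_pow, map_X, Polynomial.map_one] at this
    exact dvd_iff_isRoot.mpr (hζ.dvd this)
  obtain ⟨h, hh⟩ := hdvd
  have hdet : (N.map φ - Matrix.scalar ι ζ).det = 0 := by
    rw [IsRoot, Matrix.eval_charpoly] at hroot
    rw [← neg_sub, Matrix.det_neg, hroot, mul_zero]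
  have hpow := congrArg (fun g => (aeval (N.map φ) g).det) hh
  simp only [map_mul, map_sub, map_pow, aeval_X, map_one, aeval_C, Matrix.det_mul] at hpow
  rw [show algebraMap L (Matrix ι ι L) ζ = Matrix.scalar ι ζ from rfl, hdet, zero_mul] at hpow
  apply hφ
  rw [map_zero, RingHom.map_det, map_sub, map_pow, map_one]
  exact hpow

theorem Matrix.exists_irreducible_dvd_det_aeval_eq_zero {k R ι : Type*} [Field k] [CommRing R]
    [IsDomain R] [Algebra k R] [Fintype ι] [DecidableEq ι] (N : Matrix ι ι R) (f : k[X])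
    (hf : f ≠ 0) (hdet : (aeval N f).det = 0) :
    ∃ g, Irreducible g ∧ g ∣ f ∧ (aeval N g).det = 0 := by
  induction f using WfDvdMonoid.induction_on_irreducible with
  | zero => exact absurd rfl hf
  | unit u hu =>
    have := (hu.map (aeval N)).map Matrix.detMonoidHom
    exact absurd hdet this.ne_zero
  | mul a i ha hi ih =>
    rw [map_mul, Matrix.det_mul, mul_eq_zero] at hdet
    obtain h | h := hdet
    · exact ⟨i, hi, dvd_mul_right _ _, h⟩
    · obtain ⟨g, hg, hga, h⟩ := ih ha h
      exact ⟨g, hg, hga.mul_left i, h⟩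

theorem Matrix.dvd_charpoly_of_det_aeval_eq_zero {R ι : Type*} [CommRing R] [IsDomain R]
    [IsIntegrallyClosed R] [Fintype ι] [DecidableEq ι] (N : Matrix ι ι R) {g : R[X]}
    (hmonic : g.Monic) (hirr : Irreducible g) (hdet : (aeval N g).det = 0) : g ∣ N.charpoly := by
  let φ := algebraMap R (FractionRing R)
  have hφ : Function.Injective φ := IsFractionRing.injective R (FractionRing R)
  rw [← map_dvd_map φ hφ hmonic, ← Matrix.charpoly_map]
  by_contra hnd
  have hK := hmonic.irreducible_iff_irreducible_map_fraction_map (K := FractionRing R) |>.mp hirr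
  obtain ⟨u, v, huv⟩ := hK.coprime_iff_not_dvd.mpr hnd
  have h := congrArg (fun f => (aeval (N.map φ) f).det) huv
  have hg : aeval (N.map φ) (g.map φ) = (aeval N g).map φ := by
    rw [aeval_map_algebraMap]
    exact aeval_algHom_apply (Algebra.ofId R (FractionRing R)).mapMatrix N g
  simp only [map_add, map_mul, Matrix.aeval_self_charpoly, mul_zero, add_zero, map_one,
    Matrix.det_mul, Matrix.det_one] at h
  rw [hg, show ((aeval N g).map φ).det = φ (aeval N g).det from (RingHom.map_det φ _).symm, hdet,
    map_zero, mul_zero] at h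
  exact zero_ne_one h

theorem LaurentPolynomial.isIntegrallyClosed (k : Type*) [Field k] :
    IsIntegrallyClosed (LaurentPolynomial k) :=
  isIntegrallyClosed_of_isLocalization (R := k[X]) _ (Submonoid.powers X)
    (powers_le_nonZeroDivisors_of_noZeroDivisors X_ne_zero)

theorem Matrix.exists_not_isRelPrime_charpoly {p : ℕ} [Fact p.Prime] {ι : Type*} [Fintype ι]
    [DecidableEq ι] (N : Matrix ι ι (LaurentPolynomial (ZMod p))) {m : ℕ} (hm : m ≠ 0)
    (hdet : (N ^ m - 1).det = 0) :
    ∃ i ∈ Finset.Icc 1 (Fintype.card ι),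
      ¬ IsRelPrime N.charpoly ((X : (LaurentPolynomial (ZMod p))[X]) ^ (p ^ i - 1) - 1) := by
  have := LaurentPolynomial.isIntegrallyClosed (ZMod p)
  obtain ⟨g, hg, hgm, hdet⟩ := N.exists_irreducible_dvd_det_aeval_eq_zero
    (X ^ m - 1 : (ZMod p)[X]) (X_pow_sub_C_ne_zero (Nat.pos_of_ne_zero hm) 1) (by simpa using hdet)
  wlog hmonic : g.Monic generalizing g
  · refine this (normalize g) ((normalize_associated g).irreducible_iff.mpr hg)
      ((normalize_associated g).dvd.trans hgm) ?_ (monic_normalize hg.ne_zero)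
    obtain ⟨u, hu⟩ := associated_normalize g
    rw [← hu, map_mul, Matrix.det_mul, hdet, zero_mul]
  let φ := algebraMap (ZMod p) (LaurentPolynomial (ZMod p))
  have hirr : Irreducible (g.map φ) := by
    refine (hmonic.map φ).irreducible_of_irreducible_map
      (LaurentPolynomial.eval₂ (RingHom.id (ZMod p)) 1) _ ?_
    rwa [Polynomial.map_map, RingHom.ext_zmod (RingHom.comp _ φ) (RingHom.id _), Polynomial.map_id]
  have hchar := N.dvd_charpoly_of_det_aeval_eq_zero (hmonic.map φ) hirr
    (by rwa [aeval_map_algebraMap])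
  refine ⟨g.natDegree, Finset.mem_Icc.mpr ⟨hg.natDegree_pos, ?_⟩, ?_⟩
  · rw [← N.charpoly_natDegree_eq_dim, ← hmonic.natDegree_map φ]
    exact natDegree_le_of_dvd hchar N.charpoly_monic.ne_zero
  · intro hrel
    refine hirr.not_isUnit (hrel hchar ?_)
    have hdvd : g ∣ X ^ (p ^ g.natDegree - 1) - 1 := by
      have h := (hg.natDegree_dvd_iff_dvd_X_pow_card_pow_sub_X (n := g.natDegree)).mp dvd_rfl
      rw [Nat.card_zmod, show (X ^ p ^ g.natDegree - X : (ZMod p)[X])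
        = X * (X ^ (p ^ g.natDegree - 1) - 1) by
          rw [mul_sub, mul_one, ← pow_succ', Nat.sub_add_cancel
            (Nat.one_le_pow _ _ (Fact.out : p.Prime).pos)]] at h
      refine (hg.prime.dvd_or_dvd h).resolve_left fun hX => hg.not_isUnit ?_
      rw [isUnit_iff_dvd_one]
      exact (dvd_sub_right (hX.trans (dvd_pow_self X hm))).mp hgm
    simpa using Polynomial.map_dvd φ hdvd

/-- The `k`-basis of `ι → k[x, x⁻¹]` formed by the vectors with exactly one nonzero entry,
which is a power of `x`. -/
noncomputable def laurentVectorBasis (k ι : Type*) [Field k] [Fintype ι] :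
    Module.Basis (Σ _ : ι, ℤ) k (ι → LaurentPolynomial k) :=
  Pi.basis fun _ => AddMonoidAlgebra.basis ℤ k

theorem laurentVectorBasis_apply {k ι : Type*} [Field k] [Fintype ι] [DecidableEq ι]
    (j : ι) (z : ℤ) :
    laurentVectorBasis k ι ⟨j, z⟩ = Pi.single j (LaurentPolynomial.T z) := by
  rw [laurentVectorBasis, Pi.basis_apply]
  rfl

/-- Configurations are the linear functionals on vectors of Laurent polynomials: `c` sends the
vector with `j`-th entry `x ^ z` and all other entries zero to `c z j`. -/
noncomputable def configDual {k ι : Type*} [Field k] [Fintype ι] :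
    (ℤ → ι → k) ≃ Module.Dual k (ι → LaurentPolynomial k) where
  toFun c := (laurentVectorBasis k ι).constr k fun a => c a.2 a.1
  invFun f z j := f (laurentVectorBasis k ι ⟨j, z⟩)
  left_inv c := by ext; simp
  right_inv f := (laurentVectorBasis k ι).ext fun a => by simp

section Duality

variable {k ι : Type*} [Field k] [Fintype ι]

theorem configDual_basis (c : ℤ → ι → k) (j : ι) (z : ℤ) :
    configDual c (laurentVectorBasis k ι ⟨j, z⟩) = c z j := by
  simp [configDual]

theorem configDual_symm_apply (f : Module.Dual k (ι → LaurentPolynomial k)) (z : ℤ) (j : ι) :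
    configDual.symm f z j = f (laurentVectorBasis k ι ⟨j, z⟩) :=
  rfl

theorem configDual_zero : configDual (0 : ℤ → ι → k) = 0 :=
  (laurentVectorBasis k ι).ext fun a => by simp [configDual]

theorem continuous_configDual_apply [TopologicalSpace k] [ContinuousAdd k] [ContinuousMul k]
    (v : ι → LaurentPolynomial k) : Continuous fun c : ℤ → ι → k => configDual c v := by
  simp only [configDual, Equiv.coe_fn_mk, Module.Basis.constr_apply, Finsupp.sum, smul_eq_mul]
  fun_prop

variable {F : (ℤ → ι → k) → (ℤ → ι → k)}
  {T : (ι → LaurentPolynomial k) →ₗ[k] (ι → LaurentPolynomial k)}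

theorem configDual_iterate (hFT : ∀ c v, configDual (F c) v = configDual c (T v)) (m : ℕ)
    (c : ℤ → ι → k) (v : ι → LaurentPolynomial k) :
    configDual (F^[m] c) v = configDual c ((T ^ m) v) := by
  induction m generalizing v with
  | zero => rfl
  | succ m ih => rw [Function.iterate_succ_apply', hFT, ih, pow_succ, Module.End.mul_apply]

theorem surjective_iff_injective_of_configDual
    (hFT : ∀ c v, configDual (F c) v = configDual c (T v)) :
    Function.Surjective F ↔ Function.Injective T := by
  have h : configDual ∘ F = T.dualMap ∘ configDual := by
    funext c
    exact LinearMap.ext fun v => hFT c v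
  rw [← LinearMap.dualMap_surjective_iff, ← configDual.surjective_comp (f := T.dualMap), ← h,
    configDual.comp_surjective]

theorem TopologicallyTransitive.eq_zero_of_mapsTo_finite [TopologicalSpace k] [DiscreteTopology k]
    (hF : TopologicallyTransitive F) (hFT : ∀ c v, configDual (F c) v = configDual c (T v))
    {W : Set (ι → LaurentPolynomial k)} (hW : W.Finite) (hTW : Set.MapsTo T W W)
    {v : ι → LaurentPolynomial k} (hv : v ∈ W) : v = 0 := by
  by_contra hv0
  obtain ⟨f, hf⟩ := not_forall.mp (mt (Module.forall_dual_apply_eq_zero_iff k v).mp hv0)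
  obtain ⟨m, d, ⟨c, hc, rfl⟩, hd⟩ := hF
    (⋂ w ∈ W, {c | configDual c w = 0}) {c | configDual c v ≠ 0}
    (hW.isOpen_biInter fun w _ =>
      (isOpen_discrete {0}).preimage (continuous_configDual_apply w))
    ((isOpen_discrete {0}ᶜ).preimage (continuous_configDual_apply v))
    ⟨0, by simp [configDual_zero]⟩ ⟨configDual.symm f, by simpa using hf⟩
  refine hd ?_
  rw [configDual_iterate hFT, Module.End.pow_apply]
  exact Set.mem_iInter₂.mp hc _ (hTW.iterate m hv)

theorem TopologicallyTransitive.injective_of_configDual [TopologicalSpace k] [DiscreteTopology k]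
    (hF : TopologicallyTransitive F) (hFT : ∀ c v, configDual (F c) v = configDual c (T v)) :
    Function.Injective T := by
  refine (injective_iff_map_eq_zero T).mpr fun v hv =>
    hF.eq_zero_of_mapsTo_finite hFT (W := {v, 0}) (Set.toFinite _) ?_ (Set.mem_insert _ _)
  rintro w (rfl | rfl)
  · simp [hv]
  · simp

theorem TopologicallyTransitive.eq_zero_of_pow_apply_eq [TopologicalSpace k] [DiscreteTopology k]
    (hF : TopologicallyTransitive F) (hFT : ∀ c v, configDual (F c) v = configDual c (T v))
    {m : ℕ} (hm : m ≠ 0) {v : ι → LaurentPolynomial k} (hv : (T ^ m) v = v) : v = 0 := by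
  have hper : Function.IsPeriodicPt T m v := by
    rwa [Function.IsPeriodicPt, Function.IsFixedPt, ← Module.End.pow_apply]
  refine hF.eq_zero_of_mapsTo_finite hFT (W := (fun i => T^[i] v) '' Set.Iio m)
    ((Set.finite_Iio m).image _) ?_ ⟨0, Nat.pos_of_ne_zero hm, rfl⟩
  rintro _ ⟨i, -, rfl⟩
  refine ⟨(i + 1) % m, Nat.mod_lt _ (Nat.pos_of_ne_zero hm), ?_⟩
  simp only [hper.iterate_mod_apply, Function.iterate_succ_apply']

theorem exists_pow_apply_mem_imp_eq_zero {k D : Type*} [Field k] [AddCommGroup D] [Module k D]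
    {T : D →ₗ[k] D} (hT : Function.Injective T)
    (hper : ∀ m ≠ 0, ∀ v, (T ^ m) v = v → v = 0) (W : Submodule k D) [Finite W] :
    ∃ m : ℕ, ∀ w ∈ W, (T ^ m) w ∈ W → w = 0 := by
  by_contra! h
  choose w hw hTw hw0 using h
  obtain ⟨a, b, hab, heq⟩ := Finite.exists_ne_map_eq_of_infinite
    fun m => ((⟨w m, hw m⟩, ⟨(T ^ m) (w m), hTw m⟩) : W × W)
  simp only [Prod.mk.injEq, Subtype.mk.injEq] at heq
  obtain ⟨hwab, hTab⟩ := heq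
  wlog hlt : a < b generalizing a b
  · exact this b a hab.symm hwab.symm hTab.symm (hab.lt_or_gt.resolve_left hlt)
  refine hw0 a (hper (b - a) (Nat.sub_ne_zero_of_lt hlt) _ ?_)
  have hinj : Function.Injective (T ^ a) := by
    rw [Module.End.coe_pow]
    exact hT.iterate a
  refine hinj ?_
  rw [← Module.End.mul_apply, ← pow_add, Nat.add_sub_cancel' hlt.le, hTab, hwab]

theorem topologicallyTransitive_of_configDual [Finite k] [TopologicalSpace k]
    (hFT : ∀ c v, configDual (F c) v = configDual c (T v)) (hT : Function.Injective T)
    (hper : ∀ m ≠ 0, ∀ v, (T ^ m) v = v → v = 0) : TopologicallyTransitive F := by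
  rintro U V hU hV ⟨a, ha⟩ ⟨b, hb⟩
  obtain ⟨I, u, hu, hIU⟩ := isOpen_pi_iff.mp hU a ha
  obtain ⟨J, v, hv, hJV⟩ := isOpen_pi_iff.mp hV b hb
  let S : Set (Σ _ : ι, ℤ) := {x | x.2 ∈ I ∪ J}
  have hS : S.Finite := by
    refine ((Set.finite_univ (α := ι)).prod (I ∪ J).finite_toSet).image
      (fun x => (⟨x.1, x.2⟩ : Σ _ : ι, ℤ)) |>.subset ?_
    rintro ⟨j, z⟩ hz
    exact ⟨(j, z), ⟨Set.mem_univ _, hz⟩, rfl⟩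
  let W := Submodule.span k (laurentVectorBasis k ι '' S)
  have hW : ∀ z ∈ I ∪ J, ∀ j, laurentVectorBasis k ι ⟨j, z⟩ ∈ W := fun z hz j =>
    Submodule.subset_span ⟨⟨j, z⟩, hz, rfl⟩
  have : Module.Finite k W := Module.Finite.span_of_finite k (hS.image _)
  have : Finite W := Module.finite_of_finite k
  obtain ⟨m, hm⟩ := exists_pow_apply_mem_imp_eq_zero hT hper W
  let L : (W × W) →ₗ[k] (ι → LaurentPolynomial k) :=
    W.subtype.coprod ((T ^ m) ∘ₗ W.subtype)
  have hL : L.ker = ⊥ := by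
    rw [LinearMap.ker_eq_bot']
    rintro ⟨⟨x, hx⟩, ⟨y, hy⟩⟩ h
    have hxy : x + (T ^ m) y = 0 := h
    have hy0 : y = 0 := hm y hy (by
      rw [← neg_eq_of_add_eq_zero_right hxy]
      exact W.neg_mem hx)
    subst hy0
    simpa using hxy
  obtain ⟨g, hg⟩ := L.exists_leftInverse_of_injective hL
  let f : Module.Dual k (ι → LaurentPolynomial k) :=
    ((configDual a ∘ₗ W.subtype).coprod (configDual b ∘ₗ W.subtype)) ∘ₗ g
  have hf : ∀ x y : W, f (x + (T ^ m) y) = configDual a x + configDual b y := fun x y => by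
    have h : g (x + (T ^ m) y) = (x, y) := LinearMap.congr_fun hg (x, y)
    simp [f, h]
  have hfa : ∀ z ∈ I ∪ J, configDual.symm f z = a z := fun z hz => by
    funext j
    simpa [configDual_basis, configDual_symm_apply] using hf ⟨_, hW z hz j⟩ 0
  have hfb : ∀ z ∈ I ∪ J, F^[m] (configDual.symm f) z = b z := fun z hz => by
    funext j
    rw [← configDual_basis (F^[m] _), configDual_iterate hFT, Equiv.apply_symm_apply]
    simpa [configDual_basis] using hf 0 ⟨_, hW z hz j⟩
  refine ⟨m, _, ⟨configDual.symm f, hIU fun z hz => ?_, rfl⟩, hJV fun z hz => ?_⟩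
  · rw [hfa z (Finset.mem_union_left _ hz)]
    exact (hu z hz).2
  · rw [hfb z (Finset.mem_union_right _ hz)]
    exact (hv z hz).2

theorem configDual_linearCellularAutomaton [DecidableEq ι] {s : Finset ℤ} {A : ℤ → Matrix ι ι k}
    (hF : ∀ c z, F c z = ∑ u ∈ s, (A u).mulVec (c (z + u))) (c : ℤ → ι → k)
    (v : ι → LaurentPolynomial k) :
    configDual (F c) v = configDual c
      ((∑ u ∈ s, (LaurentPolynomial.T u : LaurentPolynomial k) •
        (A u).map LaurentPolynomial.C).transpose.mulVec v) := by
  let N := (∑ u ∈ s, (LaurentPolynomial.T u : LaurentPolynomial k) •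
        (A u).map LaurentPolynomial.C).transpose
  change configDual (F c) v = (configDual c ∘ₗ (N.mulVecLin.restrictScalars k)) v
  congr 1
  refine (laurentVectorBasis k ι).ext fun ⟨j, z⟩ => ?_
  have hN : N.mulVec (laurentVectorBasis k ι ⟨j, z⟩) =
      ∑ u ∈ s, ∑ i, A u j i • laurentVectorBasis k ι ⟨i, z + u⟩ := by
    funext l
    simp only [N, laurentVectorBasis_apply, Matrix.mulVec_single, Matrix.transpose_apply,
      Matrix.sum_apply, Matrix.smul_apply, Matrix.map_apply, Finset.sum_apply, Pi.smul_apply,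
      Matrix.col_apply, Pi.single_apply, smul_ite, smul_zero, Finset.sum_ite_eq,
      Finset.mem_univ, if_true, smul_eq_mul, op_smul_eq_mul, Finset.sum_mul,
      LaurentPolynomial.T_add, LaurentPolynomial.smul_eq_C_mul]
    exact Finset.sum_congr rfl fun _ _ => by ring
  rw [configDual_basis, LinearMap.comp_apply, LinearMap.restrictScalars_apply,
    Matrix.mulVecLin_apply, hN, hF]
  simp [configDual_basis, Matrix.mulVec, dotProduct]

end Duality

theorem stmt12 (p : ℕ) (hp : p.Prime) (n : ℕ) (hn : 1 ≤ n)
    (s : Finset ℤ) (A : ℤ → Matrix (Fin n) (Fin n) (ZMod p))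
    (F : (ℤ → Fin n → ZMod p) → (ℤ → Fin n → ZMod p))
    (hF : ∀ (c : ℤ → Fin n → ZMod p) (z : ℤ),
      F c z = ∑ u ∈ s, (A u).mulVec (c (z + u))) :
    letI : TopologicalSpace (ZMod p) := ⊥
    (TopologicallyTransitive F ↔
      Function.Surjective F ∧
        ∀ i ∈ Finset.Icc 1 n,
          IsRelPrime
            (Matrix.charpoly
              (∑ u ∈ s, (LaurentPolynomial.T u : LaurentPolynomial (ZMod p)) •
                (A u).map LaurentPolynomial.C))
            ((Polynomial.X : Polynomial (LaurentPolynomial (ZMod p))) ^ (p ^ i - 1) - 1)) := by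
  have : Fact p.Prime := ⟨hp⟩
  let N := (∑ u ∈ s, (LaurentPolynomial.T u : LaurentPolynomial (ZMod p)) •
    (A u).map LaurentPolynomial.C).transpose
  let T := N.mulVecLin.restrictScalars (ZMod p)
  have hFT : ∀ c v, configDual (F c) v = configDual c (T v) :=
    configDual_linearCellularAutomaton hF
  have hTpow : ∀ m v, (T ^ m) v = (N ^ m).mulVec v := fun m v => by
    induction m with
    | zero => simp
    | succ m ih =>
      rw [pow_succ', Module.End.mul_apply, ih, pow_succ', ← Matrix.mulVec_mulVec]
      rfl
  have hfix : ∀ m v, (T ^ m) v = v ↔ (N ^ m - 1).mulVec v = 0 := fun m v => by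
    rw [hTpow, Matrix.sub_mulVec, Matrix.one_mulVec, sub_eq_zero]
  let : TopologicalSpace (ZMod p) := ⊥
  have : DiscreteTopology (ZMod p) := ⟨rfl⟩
  rw [← Matrix.charpoly_transpose]
  constructor
  · intro h
    refine ⟨(surjective_iff_injective_of_configDual hFT).mpr (h.injective_of_configDual hFT),
      fun i hi f hchar hdvd => ?_⟩
    by_contra hf
    obtain ⟨v, hv0, hv⟩ := Matrix.exists_mulVec_eq_zero_iff.mpr
      (N.det_pow_sub_one_eq_zero_of_dvd_charpoly _ hf hchar hdvd)
    have hq : p ^ i - 1 ≠ 0 := Nat.sub_ne_zero_of_lt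
      (Nat.one_lt_pow (Nat.one_le_iff_ne_zero.mp (Finset.mem_Icc.mp hi).1) hp.one_lt)
    exact hv0 (h.eq_zero_of_pow_apply_eq hFT hq ((hfix _ _).mpr hv))
  · rintro ⟨hsurj, hrel⟩
    refine topologicallyTransitive_of_configDual hFT
      ((surjective_iff_injective_of_configDual hFT).mp hsurj) fun m hm v hv => ?_
    by_contra hv0
    obtain ⟨i, hi, hnot⟩ := N.exists_not_isRelPrime_charpoly hm
      (Matrix.exists_mulVec_eq_zero_iff.mp ⟨v, hv0, (hfix m v).mp hv⟩)
    rw [Fintype.card_fin] at hi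
    exact hnot (hrel i hi)
end

section
/- Fix a prime p and integers n ≥ 1, d ≥ 1. Let s ⊆ Z^d be a finite set and let A_u ∈ M_n(Z/pZ) for u ∈ s be matrices defining the d-dimensional linear cellular automaton F on ((Z/pZ)^n)^{Z^d} by F(c)_v = Σ_{u∈s} A_u · c_{v+u}. Let R be the group algebra of Z^d over Z/pZ (the d-variate Laurent polynomial ring, i.e. the monoid algebra AddMonoidAlgebra (Z/pZ) Z^d), let M = Σ_{u∈s} x^u A_u ∈ M_n(R) (where x^u denotes the basis element single u 1 of R), and let χ(t) ∈ R[t] be the characteristic polynomial of M. Then F is topologically transitive if and only if F is surjective and, for every i ∈ {1, …, n}, χ(t) and t^{p^i − 1} − 1 are relatively prime in R[t] (every common divisor is a unit). -/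
open Polynomial

section Pairing

variable {K G ι : Type*} [Field K] [Fintype ι] [DecidableEq ι]

/-- The `K`-linear functional on `K[G]^ι` whose value on the monomial `x ^ g` in coordinate `j`
is `c g j`. -/
noncomputable def configPairing (c : G → ι → K) : (ι → AddMonoidAlgebra K G) →ₗ[K] K :=
  ∑ j, ((Finsupp.linearCombination K fun g => c g j) ∘ₗ
    (AddMonoidAlgebra.coeffLinearEquiv K).toLinearMap) ∘ₗ LinearMap.proj j

omit [DecidableEq ι] in
theorem configPairing_apply (c : G → ι → K) (r : ι → AddMonoidAlgebra K G) :
    configPairing c r = ∑ j, (r j).coeff.sum fun g a => a * c g j := by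
  simp [configPairing, Finsupp.linearCombination_apply]

theorem configPairing_single (c : G → ι → K) (j : ι) (g : G) (a : K) :
    configPairing c (Pi.single j (AddMonoidAlgebra.single g a)) = a * c g j := by
  rw [configPairing_apply, Finset.sum_eq_single j]
  · simp
  · intro i _ hi
    simp [Pi.single_eq_of_ne hi]
  · simp

theorem configPairing_surjective (f : (ι → AddMonoidAlgebra K G) →ₗ[K] K) :
    ∃ c : G → ι → K, configPairing c = f := by
  refine ⟨fun g j => f (Pi.single j (AddMonoidAlgebra.single g 1)), ?_⟩
  refine LinearMap.pi_ext' fun j => AddMonoidAlgebra.lhom_ext' fun g => LinearMap.ext_ring ?_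
  simp [configPairing_single]

theorem exists_configPairing_ne_zero {r : ι → AddMonoidAlgebra K G} (hr : r ≠ 0) :
    ∃ c : G → ι → K, configPairing c r ≠ 0 := by
  by_contra! h
  refine hr ((Module.forall_dual_apply_eq_zero_iff K r).1 fun f => ?_)
  obtain ⟨c, rfl⟩ := configPairing_surjective f
  exact h c

theorem configPairing_eq_of_single {a c : G → ι → K} {g : G}
    (h : ∀ j, configPairing c (Pi.single j (AddMonoidAlgebra.single g 1)) =
      configPairing a (Pi.single j (AddMonoidAlgebra.single g 1))) : c g = a g := by
  funext j
  simpa [configPairing_single] using h j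

omit [DecidableEq ι] in
theorem continuous_configPairing [TopologicalSpace K] [DiscreteTopology K]
    (r : ι → AddMonoidAlgebra K G) : Continuous fun c : G → ι → K => configPairing c r := by
  simp only [configPairing_apply, Finsupp.sum]
  fun_prop

variable [AddCommGroup G]

/-- The Laurent polynomial matrix `∑ u ∈ s, x ^ u • A u` of a linear cellular automaton. -/
noncomputable abbrev symbolMatrix (s : Finset G) (A : G → Matrix ι ι K) :
    Matrix ι ι (AddMonoidAlgebra K G) :=
  ∑ u ∈ s, (AddMonoidAlgebra.single u 1 : AddMonoidAlgebra K G) •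
    (A u).map (algebraMap K (AddMonoidAlgebra K G))

variable {s : Finset G} {A : G → Matrix ι ι K} {F : (G → ι → K) → (G → ι → K)}
  (hF : ∀ (c : G → ι → K) (v : G), F c v = ∑ u ∈ s, (A u).mulVec (c (v + u)))

include hF

theorem configPairing_map (c : G → ι → K) (r : ι → AddMonoidAlgebra K G) :
    configPairing (F c) r = configPairing c (Matrix.vecMul r (symbolMatrix s A)) := by
  suffices h : configPairing (F c) =
      configPairing c ∘ₗ (symbolMatrix s A).vecMulLinear.restrictScalars K from
    LinearMap.congr_fun h r
  refine LinearMap.pi_ext' fun j => AddMonoidAlgebra.lhom_ext' fun g => LinearMap.ext_ring ?_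
  have hsum : Matrix.vecMul (Pi.single j (AddMonoidAlgebra.single g 1)) (symbolMatrix s A) =
      ∑ u ∈ s, ∑ l, Pi.single l (AddMonoidAlgebra.single (g + u) (A u j l)) := by
    rw [symbolMatrix, Matrix.vecMul_sum]
    refine Finset.sum_congr rfl fun u _ => ?_
    rw [Finset.univ_sum_single]
    funext l
    simp [AddMonoidAlgebra.single_mul_single]
  have hleft : configPairing (F c) (Pi.single j (AddMonoidAlgebra.single g 1)) =
      configPairing c (Matrix.vecMul (Pi.single j (AddMonoidAlgebra.single g 1))
        (symbolMatrix s A)) := by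
    simp only [hsum, map_sum, configPairing_single, hF, Matrix.mulVec, dotProduct,
      Finset.sum_apply, one_mul]
  exact hleft

theorem configPairing_iterate (k : ℕ) (c : G → ι → K) (r : ι → AddMonoidAlgebra K G) :
    configPairing (F^[k] c) r = configPairing c (Matrix.vecMul r (symbolMatrix s A ^ k)) := by
  induction k generalizing c with
  | zero => simp
  | succ k ih =>
    rw [Function.iterate_succ_apply, ih, configPairing_map hF, Matrix.vecMul_vecMul, pow_succ]

variable [IsDomain (AddMonoidAlgebra K G)]

theorem det_ne_zero_of_surjective (h : Function.Surjective F) : (symbolMatrix s A).det ≠ 0 := by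
  intro hdet
  obtain ⟨r, hr, hr0⟩ := Matrix.exists_vecMul_eq_zero_iff.2 hdet
  obtain ⟨c, hc⟩ := exists_configPairing_ne_zero hr
  obtain ⟨b, rfl⟩ := h c
  rw [configPairing_map hF, hr0, map_zero] at hc
  exact hc rfl

theorem surjective_of_det_ne_zero (h : (symbolMatrix s A).det ≠ 0) : Function.Surjective F := by
  intro b
  let N := (symbolMatrix s A).vecMulLinear.restrictScalars K
  have hN : Function.Injective N := by
    rw [← LinearMap.ker_eq_bot, LinearMap.ker_eq_bot']
    intro r hr
    by_contra hr0
    exact h (Matrix.exists_vecMul_eq_zero_iff.1 ⟨r, hr0, hr⟩)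
  obtain ⟨f, hf⟩ := LinearMap.dualMap_surjective_of_injective hN (configPairing b)
  obtain ⟨c, rfl⟩ := configPairing_surjective f
  refine ⟨c, ?_⟩
  funext g
  refine configPairing_eq_of_single fun j => ?_
  rw [configPairing_map hF, ← hf]
  rfl

variable [TopologicalSpace K] [DiscreteTopology K]

theorem det_ne_zero_of_transitive (h : TopologicallyTransitive F) :
    (symbolMatrix s A).det ≠ 0 := by
  intro hdet
  obtain ⟨r, hr, hr0⟩ := Matrix.exists_vecMul_eq_zero_iff.2 hdet
  obtain ⟨b, hb⟩ := exists_configPairing_ne_zero hr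
  have hcont := continuous_configPairing r
  obtain ⟨k, _, ⟨c, hc, rfl⟩, hk⟩ := h {c | configPairing c r = 0} {c | configPairing c r ≠ 0}
    ((isOpen_discrete {0}).preimage hcont) ((isOpen_discrete {0}ᶜ).preimage hcont)
    ⟨0, by simp [configPairing_apply]⟩ ⟨b, hb⟩
  rw [Set.mem_ofPred_eq, configPairing_iterate hF] at hk
  cases k with
  | zero => exact hk (by simpa using hc)
  | succ k => exact hk (by rw [pow_succ', ← Matrix.vecMul_vecMul, hr0]; simp)

theorem det_pow_sub_one_ne_zero_of_transitive (h : TopologicallyTransitive F) {k : ℕ}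
    (hk : 0 < k) : (symbolMatrix s A ^ k - 1).det ≠ 0 := by
  intro hdet
  obtain ⟨r, hr, hr0⟩ := Matrix.exists_vecMul_eq_zero_iff.2 hdet
  rw [Matrix.vecMul_sub, Matrix.vecMul_one, sub_eq_zero] at hr0
  obtain ⟨b, hb⟩ := exists_configPairing_ne_zero hr
  have hmul (m : ℕ) : Matrix.vecMul r (symbolMatrix s A ^ (k * m)) = r := by
    induction m with
    | zero => simp
    | succ m ih => rw [Nat.mul_succ, pow_add, ← Matrix.vecMul_vecMul, ih, hr0]
  obtain ⟨m, _, ⟨c, hc, rfl⟩, hm⟩ := h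
    (⋂ j ∈ Finset.range k, {c | configPairing c (Matrix.vecMul r (symbolMatrix s A ^ j)) = 0})
    {c | configPairing c r ≠ 0}
    (isOpen_biInter_finset fun j _ =>
      (isOpen_discrete {0}).preimage (continuous_configPairing _))
    ((isOpen_discrete {0}ᶜ).preimage (continuous_configPairing r))
    ⟨0, by simp [configPairing_apply]⟩ ⟨b, hb⟩
  rw [Set.mem_ofPred_eq, configPairing_iterate hF, ← Nat.div_add_mod m k, pow_add,
    ← Matrix.vecMul_vecMul, hmul] at hm
  rw [Set.mem_iInter₂] at hc
  exact hm (hc (m % k) (Finset.mem_range.2 (Nat.mod_lt m hk)))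

omit hF [TopologicalSpace K] [DiscreteTopology K] in
theorem exists_pow_vecMul_disjoint {M : Matrix ι ι (AddMonoidAlgebra K G)} (hM : M.det ≠ 0)
    (hk : ∀ k : ℕ, 0 < k → (M ^ k - 1).det ≠ 0)
    (E : Set (ι → AddMonoidAlgebra K G)) (hE : E.Finite) :
    ∃ k : ℕ, ∀ r ∈ E, Matrix.vecMul r (M ^ k) ∈ E → r = 0 := by
  by_contra! h
  choose r hr hrM hr0 using h
  have := hE.to_subtype
  obtain ⟨k, l, hkl, heq⟩ := Finite.exists_ne_map_eq_of_infinite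
    fun k => ((⟨r k, hr k⟩, ⟨_, hrM k⟩) : E × E)
  wlog hlt : k < l generalizing k l
  · exact this l k hkl.symm heq.symm (lt_of_le_of_ne (not_lt.1 hlt) hkl.symm)
  simp only [Prod.mk.injEq, Subtype.mk.injEq] at heq
  obtain ⟨h1, h2⟩ := heq
  refine mul_ne_zero (hk (l - k) (Nat.sub_pos_of_lt hlt)) (pow_ne_zero k hM) ?_
  rw [← Matrix.det_pow, ← Matrix.det_mul, sub_mul, ← pow_add, Nat.sub_add_cancel hlt.le, one_mul,
    ← Matrix.exists_vecMul_eq_zero_iff]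
  exact ⟨r k, hr0 k, by rw [Matrix.vecMul_sub, h2, ← h1, sub_self]⟩

omit [DiscreteTopology K] in
theorem transitive_of_det_ne_zero [Finite K] (hM : (symbolMatrix s A).det ≠ 0)
    (hk : ∀ k : ℕ, 0 < k → (symbolMatrix s A ^ k - 1).det ≠ 0) : TopologicallyTransitive F := by
  classical
  rintro U V hU hV ⟨a, ha⟩ ⟨b, hb⟩
  obtain ⟨I, u, hu, hIU⟩ := isOpen_pi_iff.1 hU a ha
  obtain ⟨J, v, hv, hJV⟩ := isOpen_pi_iff.1 hV b hb
  let B : Set (ι → AddMonoidAlgebra K G) := Set.image2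
    (fun j g => Pi.single j (AddMonoidAlgebra.single g 1)) Set.univ (I ∪ J : Finset G)
  have hB : B.Finite := Set.Finite.image2 _ Set.finite_univ (Finset.finite_toSet _)
  let E := Submodule.span K B
  have hEfd : FiniteDimensional K E := FiniteDimensional.span_of_finite K hB
  have hE : Finite E := Module.finite_of_finite K
  obtain ⟨k, hkE⟩ := exists_pow_vecMul_disjoint hM hk (E : Set (ι → AddMonoidAlgebra K G))
    (Set.toFinite _)
  let N := (symbolMatrix s A ^ k).vecMulLinear.restrictScalars K
  have hinj : Function.Injective (E.subtype.coprod (N ∘ₗ E.subtype)) := by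
    rw [← LinearMap.ker_eq_bot, LinearMap.ker_eq_bot']
    rintro ⟨e, e'⟩ h
    have h' : (e : ι → AddMonoidAlgebra K G) +
        Matrix.vecMul (e' : ι → AddMonoidAlgebra K G) (symbolMatrix s A ^ k) = 0 := h
    have he' : (e' : ι → AddMonoidAlgebra K G) = 0 := by
      refine hkE _ e'.2 ?_
      rw [eq_neg_of_add_eq_zero_right h']
      exact E.neg_mem e.2
    rw [he', Matrix.zero_vecMul, add_zero] at h'
    exact Prod.ext (Subtype.ext h') (Subtype.ext he')
  obtain ⟨f, hf⟩ := LinearMap.dualMap_surjective_of_injective hinj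
    ((configPairing a ∘ₗ E.subtype).coprod (configPairing b ∘ₗ E.subtype))
  obtain ⟨c, rfl⟩ := configPairing_surjective f
  have hmem {g : G} (hg : g ∈ I ∪ J) (j : ι) :
      Pi.single j (AddMonoidAlgebra.single g 1) ∈ E :=
    Submodule.subset_span ⟨j, Set.mem_univ j, g, hg, rfl⟩
  refine ⟨k, F^[k] c, ⟨c, hIU fun g hg => ?_, rfl⟩, hJV fun g hg => ?_⟩
  · have : c g = a g := configPairing_eq_of_single fun j => by
      simpa using LinearMap.congr_fun hf (⟨_, hmem (Finset.mem_union_left _ hg) j⟩, 0)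
    exact this ▸ (hu g hg).2
  · have : F^[k] c g = b g := configPairing_eq_of_single fun j => by
      rw [configPairing_iterate hF]
      simpa [N] using LinearMap.congr_fun hf (0, ⟨_, hmem (Finset.mem_union_right _ hg) j⟩)
    exact this ▸ (hv g hg).2

theorem transitive_iff_det_ne_zero [Finite K] : TopologicallyTransitive F ↔
    Function.Surjective F ∧ ∀ k : ℕ, 0 < k → (symbolMatrix s A ^ k - 1).det ≠ 0 :=
  ⟨fun h => ⟨surjective_of_det_ne_zero hF (det_ne_zero_of_transitive hF h),
    fun _ hk => det_pow_sub_one_ne_zero_of_transitive hF h hk⟩,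
  fun h => transitive_of_det_ne_zero hF (det_ne_zero_of_surjective hF h.1) h.2⟩

end Pairing

section Charpoly

variable {ι : Type*} [Fintype ι] [DecidableEq ι]

/-- Over a domain, if `f(M)` is singular for a split monic `f`, some root of `f` is a root of the
characteristic polynomial of `M`. -/
theorem Matrix.exists_root_charpoly_of_det_aeval_eq_zero {L B : Type*} [Field L] [CommRing B]
    [IsDomain B] [Algebra L B] (M : Matrix ι ι B) {f : L[X]} (hf : f.Monic) (hs : f.Splits)
    (h : (aeval M f).det = 0) : ∃ a : L, f.IsRoot a ∧ M.charpoly.eval (algebraMap L B a) = 0 := by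
  let D : L[X] →* B := Matrix.detMonoidHom.comp (aeval M : L[X] →ₐ[L] Matrix ι ι B).toRingHom.toMonoidHom
  have hD : D f = 0 := h
  rw [hs.eq_prod_roots_of_monic hf, map_multiset_prod, Multiset.prod_eq_zero_iff,
    Multiset.map_map, Multiset.mem_map] at hD
  obtain ⟨a, ha, hDa⟩ := hD
  refine ⟨a, isRoot_of_mem_roots ha, ?_⟩
  have hdet : (M - Matrix.scalar ι (algebraMap L B a)).det = 0 := by
    have hscalar : Matrix.scalar ι (algebraMap L B a) = algebraMap L (Matrix ι ι B) a := rfl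
    rw [hscalar]
    simpa [D] using hDa
  rw [Matrix.eval_charpoly, ← neg_sub, Matrix.det_neg, hdet, mul_zero]

/-- Over a domain, if `M ^ k - 1` is nonsingular, every common divisor of the characteristic
polynomial of `M` and `X ^ k - 1` is a unit. -/
theorem Matrix.isRelPrime_charpoly_X_pow_sub_one {R : Type*} [CommRing R] [IsDomain R]
    (M : Matrix ι ι R) {k : ℕ} (hk : 0 < k) (h : (M ^ k - 1).det ≠ 0) :
    IsRelPrime M.charpoly (X ^ k - 1 : R[X]) := by
  intro g hg1 hg2
  by_contra hg
  obtain ⟨q, hq⟩ := hg2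
  have hmonic : (X ^ k - 1 : R[X]).Monic := monic_X_pow_sub_C 1 hk.ne'
  have hlead : IsUnit g.leadingCoeff := by
    refine IsUnit.of_mul_eq_one q.leadingCoeff ?_
    rw [← leadingCoeff_mul, ← hq, hmonic.leadingCoeff]
  let S := AlgebraicClosure (FractionRing R)
  have hinj : Function.Injective (algebraMap R S) := by
    rw [IsScalarTower.algebraMap_eq R (FractionRing R) S]
    exact (algebraMap (FractionRing R) S).injective.comp (IsFractionRing.injective R _)
  have hdeg : (g.map (algebraMap R S)).degree ≠ 0 := by
    rw [degree_map_eq_of_injective hinj]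
    intro h0
    rw [eq_C_of_degree_eq_zero h0] at hg hlead
    rw [leadingCoeff_C] at hlead
    exact hg (hlead.map C)
  obtain ⟨a, ha⟩ := IsAlgClosed.exists_root _ hdeg
  have hroot {f : R[X]} (hf : g ∣ f) : (f.map (algebraMap R S)).eval a = 0 :=
    ha.dvd (Polynomial.map_dvd _ hf)
  have hak : a ^ k = 1 := by
    simpa [sub_eq_zero] using hroot ⟨q, hq⟩
  have hchar := hroot hg1
  rw [← Matrix.charpoly_map, Matrix.eval_charpoly, ← Matrix.exists_mulVec_eq_zero_iff] at hchar
  obtain ⟨v, hv, hMv⟩ := hchar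
  rw [Matrix.sub_mulVec, sub_eq_zero] at hMv
  have hMv' : (M.map (algebraMap R S)).mulVec v = a • v := by
    rw [← hMv]
    ext i
    simp [Matrix.mulVec_diagonal]
  have hpow (m : ℕ) : ((M.map (algebraMap R S)) ^ m).mulVec v = a ^ m • v := by
    induction m with
    | zero => simp
    | succ m ih => rw [pow_succ, ← Matrix.mulVec_mulVec, hMv', Matrix.mulVec_smul, ih, smul_smul,
        pow_succ']
  refine h (hinj ?_)
  rw [map_zero, RingHom.map_det, map_sub, map_pow, map_one, ← Matrix.exists_mulVec_eq_zero_iff]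
  exact ⟨v, hv, by
    rw [Matrix.sub_mulVec, RingHom.mapMatrix_apply, hpow, hak, one_smul, Matrix.one_mulVec,
      sub_self]⟩

end Charpoly

section FiniteField

variable {K G : Type*} [Field K] [AddCommGroup G]

/-- A polynomial over `K[G]` which vanishes at an element `a` integral over `K` is divisible by
the minimal polynomial of `a` over `K`. -/
theorem minpoly_map_dvd_of_eval₂_eq_zero {L : Type*} [Field L] [Algebra K L] {a : L}
    (ha : IsIntegral K a) {f : (AddMonoidAlgebra K G)[X]}
    (hf : f.eval₂ (AddMonoidAlgebra.mapRingHom G (algebraMap K L))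
      (algebraMap L (AddMonoidAlgebra L G) a) = 0) :
    (minpoly K a).map (algebraMap K (AddMonoidAlgebra K G)) ∣ f := by
  set φ := AddMonoidAlgebra.mapRingHom G (algebraMap K L)
  set α := algebraMap L (AddMonoidAlgebra L G) a with hα
  set μ := (minpoly K a).map (algebraMap K (AddMonoidAlgebra K G)) with hμ
  have hmonic : μ.Monic := (minpoly.monic ha).map _
  have hφ : φ.comp (algebraMap K (AddMonoidAlgebra K G)) =
      (algebraMap L (AddMonoidAlgebra L G)).comp (algebraMap K L) :=
    AddMonoidAlgebra.mapRingHom_comp_algebraMap _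
  have hμ0 : μ.eval₂ φ α = 0 := by
    rw [hμ, eval₂_map, hφ, hα, ← Polynomial.hom_eval₂, ← aeval_def, minpoly.aeval, map_zero]
  rw [← modByMonic_eq_zero_iff_dvd hmonic]
  set r := f %ₘ μ
  have hr0 : r.eval₂ φ α = 0 := by
    rw [← hf, ← modByMonic_add_div f μ, eval₂_add, eval₂_mul, hμ0, zero_mul, add_zero]
  have hdeg : r.degree < (minpoly K a).degree := by
    refine (degree_modByMonic_lt f hmonic).trans_le ?_
    exact degree_map_le
  set m := (minpoly K a).natDegree with hm
  have hrm : r.degree < m := by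
    rwa [degree_eq_natDegree (minpoly.ne_zero ha)] at hdeg
  ext1 i
  ext g
  let ρ : K[X] := ∑ i ∈ Finset.range m, monomial i ((r.coeff i).coeff g)
  have hρdeg : ρ.degree < (minpoly K a).degree := by
    rw [degree_eq_natDegree (minpoly.ne_zero ha), degree_lt_iff_coeff_zero]
    intro l hl
    simp only [ρ, finsetSum_coeff, coeff_monomial]
    exact Finset.sum_eq_zero fun i hi => if_neg (by have := Finset.mem_range.1 hi; omega)
  have hρroot : aeval a ρ = 0 := by
    have hcoeff := congrArg (fun x : AddMonoidAlgebra L G => x.coeff g) hr0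
    have hterm (x : AddMonoidAlgebra K G) (l : ℕ) :
        (φ x * α ^ l).coeff g = algebraMap K L (x.coeff g) * a ^ l := by
      rw [hα, ← map_pow, mul_comm, ← Algebra.smul_def]
      simp [φ, mul_comm]
    have hnat : r.natDegree < m := by
      rcases eq_or_ne r 0 with h0 | h0
      · simpa [h0] using minpoly.natDegree_pos ha
      · exact (natDegree_lt_iff_degree_lt h0).2 hrm
    rw [eval₂_eq_sum_range' φ hnat] at hcoeff
    simpa [ρ, aeval_monomial, hterm] using hcoeff
  have hρ0 : ρ = 0 := eq_zero_of_dvd_of_degree_lt (minpoly.dvd K a hρroot) hρdeg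
  by_cases hi : i < m
  · have := congrArg (fun q : K[X] => q.coeff i) hρ0
    simpa [ρ, finsetSum_coeff, coeff_monomial, hi] using this
  · rw [coeff_eq_zero_of_degree_lt (hrm.trans_le (by exact_mod_cast not_lt.1 hi))]
    simp

variable {ι : Type*} [Fintype ι] [DecidableEq ι] [UniqueSums G]

/-- If `M ^ k - 1` is singular, then the characteristic polynomial of `M` is divisible by an
irreducible polynomial over `K` which divides `X ^ k - 1`. -/
theorem exists_irreducible_dvd_charpoly (M : Matrix ι ι (AddMonoidAlgebra K G)) {k : ℕ}
    (hk : 0 < k) (h : (M ^ k - 1).det = 0) :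
    ∃ μ : K[X], Irreducible μ ∧ μ.Monic ∧ μ ∣ X ^ k - 1 ∧
      μ.map (algebraMap K (AddMonoidAlgebra K G)) ∣ M.charpoly := by
  let L := AlgebraicClosure K
  let φ := AddMonoidAlgebra.mapRingHom G (algebraMap K L)
  have hdom : IsDomain (AddMonoidAlgebra L G) := NoZeroDivisors.to_isDomain _
  obtain ⟨a, ha, hMa⟩ := Matrix.exists_root_charpoly_of_det_aeval_eq_zero (φ.mapMatrix M)
    (f := (X ^ k - 1 : L[X])) (monic_X_pow_sub_C 1 hk.ne') (IsAlgClosed.splits _) (by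
      have h' := φ.map_det (M ^ k - 1)
      rw [h, map_zero, map_sub, map_pow, map_one] at h'
      simpa using h'.symm)
  have hint : IsIntegral K a := Algebra.IsIntegral.isIntegral a
  refine ⟨minpoly K a, minpoly.irreducible hint, minpoly.monic hint,
    minpoly.dvd K a (by simpa using ha), minpoly_map_dvd_of_eval₂_eq_zero hint ?_⟩
  rwa [RingHom.mapMatrix_apply, Matrix.charpoly_map, eval_map] at hMa

theorem forall_det_pow_sub_one_ne_zero_iff [Finite K] (M : Matrix ι ι (AddMonoidAlgebra K G)) :
    (∀ k : ℕ, 0 < k → (M ^ k - 1).det ≠ 0) ↔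
      ∀ i ∈ Finset.Icc 1 (Fintype.card ι),
        IsRelPrime M.charpoly (X ^ (Nat.card K ^ i - 1) - 1) := by
  have hdom : IsDomain (AddMonoidAlgebra K G) := NoZeroDivisors.to_isDomain _
  have hpos {i : ℕ} (hi : 1 ≤ i) : 0 < Nat.card K ^ i - 1 :=
    Nat.sub_pos_of_lt (Nat.one_lt_pow (by omega) Finite.one_lt_card)
  constructor
  · intro h i hi
    have hi' := hpos (Finset.mem_Icc.1 hi).1
    exact M.isRelPrime_charpoly_X_pow_sub_one hi' (h _ hi')
  · intro h k hk hdet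
    obtain ⟨μ, hirr, hmonic, hμk, hμM⟩ := exists_irreducible_dvd_charpoly M hk hdet
    have hmap := hmonic.map (algebraMap K (AddMonoidAlgebra K G))
    have hdeg : (μ.map (algebraMap K (AddMonoidAlgebra K G))).natDegree = μ.natDegree :=
      hmonic.natDegree_map _
    have hle : μ.natDegree ≤ Fintype.card ι := by
      rw [← hdeg, ← M.charpoly_natDegree_eq_dim]
      exact natDegree_le_of_dvd hμM M.charpoly_monic.ne_zero
    have hμ : μ ∣ X ^ (Nat.card K ^ μ.natDegree - 1) - 1 := by
      have hdvd := hirr.natDegree_dvd_iff_dvd_X_pow_card_pow_sub_X.1 (dvd_refl μ.natDegree)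
      have hfac : (X ^ Nat.card K ^ μ.natDegree - X : K[X]) =
          X * (X ^ (Nat.card K ^ μ.natDegree - 1) - 1) := by
        rw [mul_sub, mul_one, ← pow_succ', Nat.sub_add_cancel (Nat.one_le_pow _ _ Nat.card_pos)]
      rw [hfac] at hdvd
      refine (hirr.prime.dvd_or_dvd hdvd).resolve_left fun hX => hirr.not_isUnit ?_
      have h1 : μ ∣ X ^ k := hX.trans (dvd_pow_self X hk.ne')
      exact isUnit_of_dvd_one (by simpa using dvd_sub h1 hμk)
    have hunit := h μ.natDegree (Finset.mem_Icc.2 ⟨hirr.natDegree_pos, hle⟩) hμM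
      (by simpa using Polynomial.map_dvd (algebraMap K (AddMonoidAlgebra K G)) hμ)
    have h0 := hirr.natDegree_pos
    rw [← hdeg, natDegree_eq_zero_of_isUnit hunit] at h0
    exact lt_irrefl 0 h0

end FiniteField

theorem stmt13 (p : ℕ) (hp : p.Prime) (n : ℕ) (hn : 1 ≤ n) (d : ℕ) (hd : 1 ≤ d)
    (s : Finset (Fin d → ℤ)) (A : (Fin d → ℤ) → Matrix (Fin n) (Fin n) (ZMod p))
    (F : ((Fin d → ℤ) → Fin n → ZMod p) → ((Fin d → ℤ) → Fin n → ZMod p))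
    (hF : ∀ (c : (Fin d → ℤ) → Fin n → ZMod p) (v : Fin d → ℤ),
      F c v = ∑ u ∈ s, (A u).mulVec (c (v + u))) :
    letI : TopologicalSpace (ZMod p) := ⊥
    (TopologicallyTransitive F ↔
      Function.Surjective F ∧
        ∀ i ∈ Finset.Icc 1 n,
          IsRelPrime
            (Matrix.charpoly
              (∑ u ∈ s,
                (AddMonoidAlgebra.single u 1 : AddMonoidAlgebra (ZMod p) (Fin d → ℤ)) •
                  (A u).map (algebraMap (ZMod p) (AddMonoidAlgebra (ZMod p) (Fin d → ℤ)))))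
            ((Polynomial.X : Polynomial (AddMonoidAlgebra (ZMod p) (Fin d → ℤ))) ^ (p ^ i - 1)
              - 1)) := by
  let _ : TopologicalSpace (ZMod p) := ⊥
  have : Fact p.Prime := ⟨hp⟩
  have : DiscreteTopology (ZMod p) := ⟨rfl⟩
  have : IsDomain (AddMonoidAlgebra (ZMod p) (Fin d → ℤ)) := NoZeroDivisors.to_isDomain _
  have h := forall_det_pow_sub_one_ne_zero_iff (symbolMatrix s A)
  rw [Fintype.card_fin, Nat.card_zmod] at h
  rw [transitive_iff_det_ne_zero hF, h]
end
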